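/- Let T be a rooted chain complete tree, endowed with the coarse wedge topology. If the height of T is at most ω₁ + 1, then T is a Valdivia compact space, with dense Σ-subset D = {t ∈ T : cf(t) ≤ ω}. -/

import Mathlib

open Cardinal Ordinal Filter Set Topology

universe u v

section TreeDefs

variable {T : Type u} [PartialOrder T]

/-- `T` is a tree: the set of strict predecessors of every point is well-ordered by `<`. -/
def IsTreeOrder (T : Type u) [PartialOrder T] : Prop :=
  ∀ x : T, IsWellOrder {y : T // y < x} (· < ·)

/-- Every chain has a supremum. -/
def ChainComplete (T : Type u) [PartialOrder T] : Prop :=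
  ∀ c : Set T, IsChain (· ≤ ·) c → ∃ s, IsLUB c s

open Classical in
/-- The height `ht(x,T)` of `x`: the order type of the set of its strict predecessors. -/
noncomputable def htx (x : T) : Ordinal.{u} :=
  if h : IsWellOrder {y : T // y < x} (· < ·) then @Ordinal.type {y : T // y < x} (· < ·) h
  else 0

/-- The cofinality `cf(x)` of `ht(x,T)`. -/
noncomputable def cfx (x : T) : Cardinal.{u} := (htx x).cof

/-- `x` lies on a successor level. -/
def SuccLevel (x : T) : Prop := ∃ β : Ordinal, htx x = β + 1

/-- The set of immediate successors of `x`. -/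
def ims (x : T) : Set T := {y | x < y ∧ htx y = htx x + 1}

/-- The wedge `V_t = {s : t ≤ s}`. -/
def Vset (t : T) : Set T := {s | t ≤ s}

/-- Condition (*): every `t` with `cf(t) ≥ ω₁` has finitely many immediate successors. -/
def StarCond (T : Type u) [PartialOrder T] : Prop :=
  ∀ t : T, Cardinal.aleph 1 ≤ cfx t → (ims t).Finite

/-- The coarse wedge topology: generated by the sets `V_t` and their complements,
for `t` minimal or on a successor level. -/
def coarseWedge (T : Type u) [PartialOrder T] : TopologicalSpace T :=
  TopologicalSpace.generateFrom
    {U : Set T | ∃ t : T, (IsMin t ∨ SuccLevel t) ∧ (U = Vset t ∨ U = (Vset t)ᶜ)}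

open Classical in
/-- `s ∧ t = max (ŝ ∩ t̂)`, the largest common predecessor (when it exists). -/
noncomputable def wedge (s t : T) : T :=
  if h : ∃ m, IsGreatest {r : T | r ≤ s ∧ r ≤ t} m then h.choose else s

open Classical in
/-- `ψ(t) = ims(t)` if `cf(t) ≥ ω₁`, and `ψ(t) = {0}` (the root) otherwise. -/
noncomputable def psiSet (root : T) (t : T) : Set T :=
  if Cardinal.aleph 1 ≤ cfx t then ims t else {root}

/-- `φ` is a choice function assigning to every `t` with `cf(t) = ω` a sequence of
successor-level elements strictly below `t` converging to `t`, and the constant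
sequence at the root otherwise. -/
def PhiSpec [TopologicalSpace T] (root : T) (φ : T → ℕ → T) : Prop :=
  ∀ t : T,
    (cfx t ≠ Cardinal.aleph0 → ∀ n, φ t n = root) ∧
    (cfx t = Cardinal.aleph0 →
      (∀ n, φ t n < t ∧ SuccLevel (φ t n)) ∧ Tendsto (φ t) atTop (nhds t))

/-- Membership in the family `𝒜(T)`: countable subsets containing the root, closed
under `∧`, `φ` and `ψ`. -/
structure Admissible (root : T) (φ : T → ℕ → T) (A : Set T) : Prop where
  countable : A.Countable
  root_mem : root ∈ A
  wedge_mem : ∀ s ∈ A, ∀ t ∈ A, wedge s t ∈ A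
  phi_mem : ∀ t ∈ A, ∀ n, φ t n ∈ A
  psi_mem : ∀ t ∈ A, psiSet root t ⊆ A

/-- The height of the tree `T`: the least `α` such that the level `α` of `T` is empty. -/
noncomputable def treeHeight (T : Type u) [PartialOrder T] : Ordinal.{u} :=
  sInf {α : Ordinal | ∀ x : T, htx x ≠ α}

end TreeDefs

/-- A retractional skeleton on a compact space `K`: a family of continuous retractions
with metrizable compact ranges, indexed by an up-directed partially ordered set,
commuting under the order, continuous under countable increasing suprema, and
converging pointwise to the identity. -/
structure RetractionalSkeleton (K : Type v) [TopologicalSpace K] where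
  Γ : Type v
  [po : PartialOrder Γ]
  [ne : Nonempty Γ]
  directed : ∀ s t : Γ, ∃ u, s ≤ u ∧ t ≤ u
  r : Γ → K → K
  cont : ∀ s, Continuous (r s)
  retraction : ∀ s x, r s (r s x) = r s x
  compact_range : ∀ s, IsCompact (Set.range (r s))
  metrizable_range : ∀ s, TopologicalSpace.MetrizableSpace (Set.range (r s))
  comm : ∀ s t : Γ, s ≤ t → ∀ x, r s (r t x) = r s x ∧ r t (r s x) = r s x
  seq_sup : ∀ s : ℕ → Γ, Monotone s → ∃ t : Γ, IsLUB (Set.range s) t ∧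
      ∀ x, Tendsto (fun n => r (s n) x) atTop (nhds (r t x))
  net_conv : ∀ x : K, Tendsto (fun s : Γ => r s x) atTop (nhds x)

/-- The subset induced by a retractional skeleton: `D = ⋃ₛ rₛ[K]`. -/
def RetractionalSkeleton.inducedSet {K : Type v} [TopologicalSpace K]
    (R : RetractionalSkeleton K) : Set K :=
  ⋃ s : R.Γ, Set.range (R.r s)

/-- `A` is a `Σ`-subset of `K`: for some homeomorphic injection `h` of `K` into a cube
`[0,1]^Γ`, `h(A) = h(K) ∩ Σ(Γ)`. -/
def IsSigmaSubset {K : Type v} [TopologicalSpace K] (A : Set K) : Prop :=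
  ∃ (Γ : Type v) (h : K → Γ → Set.Icc (0 : ℝ) 1),
    Topology.IsEmbedding h ∧
      h '' A = Set.range h ∩ {x | {γ | (x γ : ℝ) ≠ 0}.Countable}

/-- `K` is a Valdivia compact space: it has a dense `Σ`-subset. -/
def IsValdivia (K : Type v) [TopologicalSpace K] : Prop :=
  ∃ A : Set K, Dense A ∧ IsSigmaSubset A

/-- The bounded topology on a product `∏_{α<ω₁} X_α`: basic open sets are the sets
`V(g,β) = {f : f↾β = g↾β}` for `β < ω₁`. -/
def boundedTopology (X : Set.Iio (Cardinal.aleph 1).ord → Type v) :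
    TopologicalSpace (∀ α, X α) :=
  TopologicalSpace.generateFrom
    {U | ∃ (g : ∀ α, X α) (β : Ordinal), β < (Cardinal.aleph 1).ord ∧
      U = {f | ∀ α : Set.Iio (Cardinal.aleph 1).ord, (α : Ordinal) < β → f α = g α}}

section TreeLemmas

variable {T : Type u} [PartialOrder T]

theorem IsTreeOrder.htx_eq_type (h : IsTreeOrder T) (x : T) :
    haveI := h x
    htx x = Ordinal.type (fun a b : {y : T // y < x} => a < b) := by
  unfold htx
  rw [dif_pos (h x)]

theorem IsTreeOrder.htx_eq_typein (h : IsTreeOrder T) {x y : T} (hy : y < x) :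
    haveI := h x
    htx y = Ordinal.typein (fun a b : {y : T // y < x} => a < b) ⟨y, hy⟩ := by
  have := h x
  have := h y
  rw [h.htx_eq_type y, ← Ordinal.type_subrel]
  refine Ordinal.type_eq.2 ⟨⟨⟨fun z => ⟨⟨z.1, z.2.trans hy⟩, z.2⟩, fun z => ⟨z.1.1, z.2⟩,
    fun z => rfl, fun z => rfl⟩, ?_⟩⟩
  intro a b
  rfl

theorem IsTreeOrder.htx_lt_htx (h : IsTreeOrder T) {x y : T} (hy : y < x) : htx y < htx x := by
  have := h x
  rw [h.htx_eq_typein hy, h.htx_eq_type x]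
  exact Ordinal.typein_lt_type _ _

theorem IsTreeOrder.htx_le_htx (h : IsTreeOrder T) {x y : T} (hy : y ≤ x) : htx y ≤ htx x :=
  hy.eq_or_lt.elim (fun e => e ▸ le_rfl) fun hlt => (h.htx_lt_htx hlt).le

theorem IsTreeOrder.exists_htx_eq (h : IsTreeOrder T) {x : T} {α : Ordinal.{u}}
    (hα : α < htx x) : ∃ y < x, htx y = α := by
  have := h x
  rw [h.htx_eq_type x] at hα
  obtain ⟨⟨y, hy⟩, rfl⟩ := Ordinal.typein_surj (fun a b : {y : T // y < x} => a < b) hα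
  exact ⟨y, hy, h.htx_eq_typein hy⟩

theorem IsTreeOrder.card_htx (h : IsTreeOrder T) (x : T) :
    (htx x).card = #(Set.Iio x) := by
  have := h x
  rw [h.htx_eq_type x, Ordinal.card_type]
  rfl

theorem IsTreeOrder.le_or_le (h : IsTreeOrder T) {x y z : T} (hy : y ≤ x) (hz : z ≤ x) :
    y ≤ z ∨ z ≤ y := by
  rcases hy.eq_or_lt with rfl | hy
  · exact Or.inr hz
  rcases hz.eq_or_lt with rfl | hz
  · exact Or.inl hy.le
  have := h x
  rcases trichotomous_of (fun a b : {y : T // y < x} => a < b) ⟨y, hy⟩ ⟨z, hz⟩ with h1 | h1 | h1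
  · exact Or.inl (le_of_lt h1)
  · exact Or.inl (congrArg Subtype.val h1).le
  · exact Or.inr (le_of_lt h1)

theorem IsTreeOrder.exists_succLevel (h : IsTreeOrder T) {s x : T} (hs : s < x) :
    ∃ w, s < w ∧ w ≤ x ∧ SuccLevel w := by
  have key : ∃ w, s < w ∧ w ≤ x ∧ htx w = htx s + 1 := by
    have h1 : htx s + 1 ≤ htx x := Order.add_one_le_of_lt (h.htx_lt_htx hs)
    rcases h1.eq_or_lt with h1 | h1
    · exact ⟨x, hs, le_rfl, h1.symm⟩
    · obtain ⟨w, hw, hwe⟩ := h.exists_htx_eq h1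
      refine ⟨w, ?_, hw.le, hwe⟩
      have hlt : htx s < htx w := hwe ▸ lt_add_one _
      rcases h.le_or_le hw.le hs.le with h2 | h2
      · exact absurd (h.htx_le_htx h2) (not_le.2 hlt)
      · exact h2.lt_of_ne (by rintro rfl; exact lt_irrefl _ hlt)
  obtain ⟨w, h1, h2, h3⟩ := key
  exact ⟨w, h1, h2, _, h3⟩

/-- In a chain complete tree, every point is the supremum of the points below or equal to it
that lie on successor levels. -/
theorem IsTreeOrder.isLUB_succLevel (h : IsTreeOrder T) (hcc : ChainComplete T) (x : T) :
    IsLUB {t | SuccLevel t ∧ t ≤ x} x := by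
  obtain ⟨s, hs⟩ := hcc {t | SuccLevel t ∧ t ≤ x} fun a ha b hb _ => h.le_or_le ha.2 hb.2
  have hsx : s ≤ x := hs.2 fun t ht => ht.2
  rcases hsx.eq_or_lt with rfl | hlt
  · exact hs
  · obtain ⟨w, h1, h2, h3⟩ := h.exists_succLevel hlt
    exact absurd (hs.1 ⟨h3, h2⟩) h1.not_ge

theorem exists_forall_htx_ne (T : Type u) [PartialOrder T] :
    ∃ α : Ordinal.{u}, ∀ x : T, htx x ≠ α := by
  obtain ⟨b, hb⟩ : BddAbove (Set.range (htx : T → Ordinal.{u})) := Ordinal.bddAbove_of_small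
  exact ⟨b + 1, fun x hx =>
    absurd (hb ⟨x, rfl⟩) (by rw [hx]; exact not_le.2 (lt_add_one b))⟩

theorem IsTreeOrder.htx_lt_treeHeight (h : IsTreeOrder T) (x : T) : htx x < treeHeight T := by
  by_contra! hle
  have hmem : ∀ y : T, htx y ≠ treeHeight T :=
    csInf_mem (s := {α : Ordinal | ∀ x : T, htx x ≠ α}) (exists_forall_htx_ne T)
  rcases hle.eq_or_lt with he | hlt
  · exact hmem x he.symm
  · obtain ⟨y, -, hy⟩ := h.exists_htx_eq hlt
    exact hmem y hy

theorem cfx_le_aleph0_of_htx_lt {x : T} (hx : htx x < (Cardinal.aleph 1).ord) :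
    cfx x ≤ Cardinal.aleph0 :=
  (Ordinal.cof_le_card _).trans (Cardinal.lt_aleph_one_iff.1 (Cardinal.lt_ord.1 hx))

theorem aleph0_lt_cfx_of_htx_eq {x : T} (hx : htx x = (Cardinal.aleph 1).ord) :
    Cardinal.aleph0 < cfx x := by
  unfold cfx
  rw [hx, Cardinal.isRegular_aleph_one.cof_ord]
  exact Cardinal.aleph0_lt_aleph_one

theorem not_succLevel_of_htx_eq {x : T} (hx : htx x = (Cardinal.aleph 1).ord) :
    ¬ SuccLevel x := by
  rintro ⟨β, hβ⟩
  have hlim : Order.IsSuccLimit (Cardinal.aleph 1).ord :=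
    Cardinal.isSuccLimit_ord (Cardinal.aleph0_le_aleph 1)
  have h1 : β < (Cardinal.aleph 1).ord := by rw [← hx, hβ]; exact lt_add_one β
  have h2 := hlim.add_one_lt h1
  rw [← hβ, hx] at h2
  exact lt_irrefl _ h2

theorem IsTreeOrder.countable_Iio (h : IsTreeOrder T) {x : T}
    (hx : htx x < (Cardinal.aleph 1).ord) : (Set.Iio x).Countable := by
  rw [← Cardinal.le_aleph0_iff_set_countable, ← h.card_htx, ← Cardinal.lt_aleph_one_iff]
  exact Cardinal.lt_ord.1 hx

theorem IsTreeOrder.not_countable_Iio (h : IsTreeOrder T) {x : T}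
    (hx : htx x = (Cardinal.aleph 1).ord) : ¬ (Set.Iio x).Countable := by
  rw [← Cardinal.le_aleph0_iff_set_countable, ← h.card_htx, ← Cardinal.lt_aleph_one_iff, hx,
    Cardinal.card_ord]
  exact lt_irrefl _

theorem IsTreeOrder.not_countable_succLevel (h : IsTreeOrder T) {x : T}
    (hx : htx x = (Cardinal.aleph 1).ord) : ¬ {t | SuccLevel t ∧ t ≤ x}.Countable := by
  intro hc
  refine h.not_countable_Iio hx ((hc.biUnion (t := fun t _ => {y | y < t ∧ t < x}) ?_).mono ?_)
  · intro t _
    by_cases htlt : t < x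
    · exact (h.countable_Iio (hx ▸ h.htx_lt_htx htlt)).mono fun y hy => hy.1
    · exact Set.countable_empty.mono fun y hy => htlt hy.2
  · intro y hy
    obtain ⟨w, h1, h2, h3⟩ := h.exists_succLevel hy
    have hne : w ≠ x := fun e => not_succLevel_of_htx_eq hx (e ▸ h3)
    exact Set.mem_biUnion (show w ∈ {t | SuccLevel t ∧ t ≤ x} from ⟨h3, h2⟩) ⟨h1, h2.lt_of_ne hne⟩

theorem IsTreeOrder.dense_of_Iio_subset [τ : TopologicalSpace T] (hτ : τ = coarseWedge T)
    (h : IsTreeOrder T) {D : Set T}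
    (hD : ∀ x ∉ D, ¬ IsMin x ∧ ¬ SuccLevel x ∧ Set.Iio x ⊆ D) : Dense D := by
  intro x
  by_cases hx : x ∈ D
  · exact subset_closure hx
  obtain ⟨hmin, hsucc, hsub⟩ := hD x hx
  obtain ⟨y₀, hy₀⟩ := not_isMin_iff.1 hmin
  have : Nonempty (Set.Iio x) := ⟨⟨y₀, hy₀⟩⟩
  have : IsDirectedOrder (Set.Iio x) := ⟨fun a b =>
    (h.le_or_le (le_of_lt a.2) (le_of_lt b.2)).elim (fun hab => ⟨b, hab, le_rfl⟩)
      fun hba => ⟨a, le_rfl, hba⟩⟩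
  have hlim : Tendsto (fun y : Set.Iio x => (y : T)) atTop (𝓝 x) := by
    subst hτ
    refine TopologicalSpace.tendsto_nhds_generateFrom_iff.2 ?_
    rintro s ⟨t, ht, rfl | rfl⟩ hxs
    · have htx : t < x := lt_of_le_of_ne hxs (by rintro rfl; exact ht.elim hmin hsucc)
      exact Filter.mem_of_superset (Filter.Ici_mem_atTop (⟨t, htx⟩ : Set.Iio x)) fun y hy => hy
    · exact Filter.univ_mem' fun y hy => hxs (le_trans hy (le_of_lt y.2))
  exact mem_closure_of_tendsto hlim (Filter.Eventually.of_forall fun y => hsub y.2)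

open Classical in
/-- The map into the cube whose coordinates are the indicators of the subbasic wedges. -/
noncomputable def wedgeCube (x t : T) : Set.Icc (0 : ℝ) 1 :=
  if (IsMin t ∨ SuccLevel t) ∧ t ≤ x then 1 else 0

theorem wedgeCube_ne_zero_iff {x t : T} :
    (wedgeCube x t : ℝ) ≠ 0 ↔ (IsMin t ∨ SuccLevel t) ∧ t ≤ x := by
  unfold wedgeCube
  split_ifs with h <;> simp [h]

theorem continuous_wedgeCube [τ : TopologicalSpace T] (hτ : τ = coarseWedge T) :
    Continuous (wedgeCube : T → T → Set.Icc (0 : ℝ) 1) := by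
  subst hτ
  refine @continuous_pi _ _ _ (coarseWedge T) _ _ fun t => ?_
  by_cases ht : IsMin t ∨ SuccLevel t
  · have hopen : IsOpen[coarseWedge T] (Vset t) :=
      TopologicalSpace.isOpen_generateFrom_of_mem ⟨t, ht, Or.inl rfl⟩
    have hopen' : IsOpen[coarseWedge T] (Vset t)ᶜ :=
      TopologicalSpace.isOpen_generateFrom_of_mem ⟨t, ht, Or.inr rfl⟩
    let := coarseWedge T
    refine IsLocallyConstant.continuous ((IsLocallyConstant.iff_exists_open _).2 fun x => ?_)
    by_cases hx : t ≤ x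
    · refine ⟨_, hopen, hx, fun y hy => ?_⟩
      have hy : t ≤ y := hy
      simp [wedgeCube, ht, hx, hy]
    · refine ⟨_, hopen', hx, fun y hy => ?_⟩
      have hy : ¬ t ≤ y := hy
      simp [wedgeCube, ht, hx, hy]
  · simp only [wedgeCube, ht, false_and, if_false]
    exact @continuous_const _ _ (coarseWedge T) _ _

theorem isInducing_wedgeCube [τ : TopologicalSpace T] (hτ : τ = coarseWedge T) :
    Topology.IsInducing (wedgeCube : T → T → Set.Icc (0 : ℝ) 1) := by
  refine ⟨le_antisymm (continuous_wedgeCube hτ).le_induced ?_⟩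
  rw [hτ]
  refine le_generateFrom ?_
  have hcoord (t : T) : Continuous fun z : T → Set.Icc (0 : ℝ) 1 => (z t : ℝ) :=
    continuous_subtype_val.comp (continuous_apply t)
  rintro s ⟨t, ht, rfl | rfl⟩
  · refine ⟨{z | (z t : ℝ) ≠ 0}, isOpen_ne_fun (hcoord t) continuous_const, ?_⟩
    ext x
    simp only [Set.mem_preimage, Set.mem_ofPred_eq, wedgeCube_ne_zero_iff]
    exact and_iff_right ht
  · refine ⟨{z | (z t : ℝ) < 1}, isOpen_lt (hcoord t) continuous_const, ?_⟩
    ext x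
    by_cases hx : t ≤ x <;> simp [wedgeCube, Vset, ht, hx]

theorem IsTreeOrder.injective_wedgeCube (h : IsTreeOrder T) (hcc : ChainComplete T) :
    Function.Injective (wedgeCube : T → T → Set.Icc (0 : ℝ) 1) := by
  have key {x y : T} (hxy : wedgeCube x = wedgeCube y) : x ≤ y :=
    (h.isLUB_succLevel hcc x).2 fun t ht => by
      have h1 := wedgeCube_ne_zero_iff.2 ⟨Or.inr ht.1, ht.2⟩
      rw [hxy] at h1
      exact (wedgeCube_ne_zero_iff.1 h1).2
  exact fun x y hxy => le_antisymm (key hxy) (key hxy.symm)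

end TreeLemmas

theorem stmt13 {T : Type u} [PartialOrder T] [τ : TopologicalSpace T]
    (hτ : τ = coarseWedge T) (htree : IsTreeOrder T) (hcc : ChainComplete T)
    (root : T) (hroot : ∀ x : T, root ≤ x)
    (hht : treeHeight T ≤ (Cardinal.aleph 1).ord + 1) :
    IsValdivia T ∧ Dense {u : T | cfx u ≤ Cardinal.aleph0} ∧ IsSigmaSubset {u : T | cfx u ≤ Cardinal.aleph0} := by
  have hle (x : T) : htx x ≤ (Cardinal.aleph 1).ord :=
    Order.lt_add_one_iff.1 ((htree.htx_lt_treeHeight x).trans_le hht)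
  have hmem (x : T) : cfx x ≤ Cardinal.aleph0 ↔ htx x < (Cardinal.aleph 1).ord :=
    ⟨fun hx => (hle x).lt_of_ne fun he => (aleph0_lt_cfx_of_htx_eq he).not_ge hx,
      cfx_le_aleph0_of_htx_lt⟩
  have hdense : Dense {u : T | cfx u ≤ Cardinal.aleph0} := by
    refine htree.dense_of_Iio_subset hτ fun x hx => ?_
    have he : htx x = (Cardinal.aleph 1).ord :=
      (hle x).eq_of_not_lt fun hlt => hx ((hmem x).2 hlt)
    refine ⟨fun hmin => ?_, not_succLevel_of_htx_eq he, fun y hy => ?_⟩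
    · exact htree.not_countable_Iio he (by rw [hmin.Iio_eq]; exact Set.countable_empty)
    · exact (hmem y).2 (he ▸ htree.htx_lt_htx hy)
  have hsigma : IsSigmaSubset {u : T | cfx u ≤ Cardinal.aleph0} := by
    refine ⟨T, wedgeCube, ⟨isInducing_wedgeCube hτ, htree.injective_wedgeCube hcc⟩, ?_⟩
    have hsupp (x : T) : {γ | (wedgeCube x γ : ℝ) ≠ 0}.Countable ↔ cfx x ≤ Cardinal.aleph0 := by
      simp only [wedgeCube_ne_zero_iff, hmem]
      refine ⟨fun hc => (hle x).lt_of_ne fun he => ?_, fun hx => ?_⟩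
      · exact htree.not_countable_succLevel he (hc.mono fun t ht => And.intro (Or.inr ht.1) ht.2)
      · refine ((htree.countable_Iio hx).insert x).mono fun t ht => ?_
        exact ht.2.eq_or_lt
    ext z
    constructor
    · rintro ⟨x, hx, rfl⟩
      exact ⟨⟨x, rfl⟩, (hsupp x).2 hx⟩
    · rintro ⟨⟨x, rfl⟩, hz⟩
      exact ⟨x, (hsupp x).1 hz, rfl⟩
  exact ⟨⟨_, hdense, hsigma⟩, hdense, hsigma⟩
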